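/- For every utilization vector N, the weight of the up-rounding beyond the first 1/ε items of the heavy classes satisfies W_H(N^(1)) ≤ (1+2ε)·W_H(N), where W_H(N^(1)) = Σ_{ℓ∈H(N)} W_ℓ(1/ε+1, N^(1)_ℓ) (recall H(N^(1)) = H(N)). -/

import Mathlib

open Finset
open scoped Classical

noncomputable section

namespace IK

variable {ι : Type*} [Fintype ι]

/-- `Wcl wgt ℓ a b = Σ_{j=a}^{b} w_{ℓ,j}`, the total weight of items `a,…,b` of class `ℓ`. -/
def Wcl (wgt : ι → ℕ → ℝ) (ℓ : ι) (a b : ℕ) : ℝ := ∑ j ∈ Finset.Icc a b, wgt ℓ j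

/-- The set `H(N)` of classes that are heavy for `N` (here `e = 1/ε`). -/
def heavy (e : ℕ) (N : ι → ℕ) : Finset ι := Finset.univ.filter fun ℓ => e < N ℓ

/-- `W_H(N)`, the weight picked by `N` from heavy classes beyond their first `1/ε` items. -/
def WH (wgt : ι → ℕ → ℝ) (e : ℕ) (N : ι → ℕ) : ℝ :=
  ∑ ℓ ∈ heavy e N, Wcl wgt ℓ (e + 1) (N ℓ)

/-- `P2[x]`: the least integer power of `2` that is `≥ x` for `x > 0`, and `0` for `x ≤ 0`. -/
def P2 (x : ℝ) : ℝ := if 0 < x then (2 : ℝ) ^ ⌈Real.logb 2 x⌉ else 0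

/-- The rounding unit `P2[(ε/|L|)·W_H(N)]`. -/
def base (ε : ℝ) (wgt : ι → ℕ → ℝ) (e : ℕ) (N : ι → ℕ) : ℝ :=
  P2 (ε / (Fintype.card ι) * WH wgt e N)

/-- The multiplier `μ_ℓ(N)`: the unique integer with
`(μ_ℓ(N)−1)·P2[(ε/|L|)·W_H(N)] < W_ℓ(1/ε+1, N_ℓ) ≤ μ_ℓ(N)·P2[(ε/|L|)·W_H(N)]`. -/
def mu (ε : ℝ) (wgt : ι → ℕ → ℝ) (e : ℕ) (N : ι → ℕ) (ℓ : ι) : ℤ :=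
  ⌈Wcl wgt ℓ (e + 1) (N ℓ) / base ε wgt e N⌉

/-- The over-estimate `E_ℓ(N) = μ_ℓ(N)·P2[(ε/|L|)·W_H(N)]`. -/
def Ecl (ε : ℝ) (wgt : ι → ℕ → ℝ) (e : ℕ) (N : ι → ℕ) (ℓ : ι) : ℝ :=
  (mu ε wgt e N ℓ : ℝ) * base ε wgt e N

/-- The up-rounding `N^(1)` of `N`: coordinates of light classes are kept, while each heavy
class picks `max{k ∈ [1/ε+1, n_ℓ] : W_ℓ(1/ε+1, k) ≤ E_ℓ(N)}` items. -/
def upround (ε : ℝ) (wgt : ι → ℕ → ℝ) (nI : ι → ℕ) (e : ℕ) (N : ι → ℕ) : ι → ℕ :=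
  fun ℓ =>
    if e < N ℓ then
      ((Finset.Icc (e + 1) (nI ℓ)).filter fun k => Wcl wgt ℓ (e + 1) k ≤ Ecl ε wgt e N ℓ).sup id
    else N ℓ

/-- `Δ_ℓ(N) = N^(1)_ℓ − 1/ε`. -/
def delta (ε : ℝ) (wgt : ι → ℕ → ℝ) (nI : ι → ℕ) (e : ℕ) (N : ι → ℕ) (ℓ : ι) : ℕ :=
  upround ε wgt nI e N ℓ - e

/-- The truncation `N^(2)` of `N`: coordinates of light classes are kept, while each heavy
class eliminates its last `⌈2ε·Δ_ℓ(N)⌉` items from `N^(1)`. -/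
def trunc (ε : ℝ) (wgt : ι → ℕ → ℝ) (nI : ι → ℕ) (e : ℕ) (N : ι → ℕ) : ι → ℕ :=
  fun ℓ =>
    if e < N ℓ then
      upround ε wgt nI e N ℓ - (⌈2 * ε * (delta ε wgt nI e N ℓ : ℝ)⌉).toNat
    else upround ε wgt nI e N ℓ

/-- The total weight `w(N) = Σ_ℓ W_ℓ(1, N_ℓ)` of a utilization vector. -/
def wtot (wgt : ι → ℕ → ℝ) (N : ι → ℕ) : ℝ := ∑ ℓ : ι, Wcl wgt ℓ 1 (N ℓ)

end IK

namespace IK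

lemma P2_pos {x : ℝ} (hx : 0 < x) : 0 < P2 x := by
  rw [P2, if_pos hx]
  positivity

lemma P2_le_two_mul {x : ℝ} (hx : 0 < x) : P2 x ≤ 2 * x := by
  rw [P2, if_pos hx, ← Real.rpow_intCast]
  calc (2 : ℝ) ^ ((⌈Real.logb 2 x⌉ : ℤ) : ℝ)
      ≤ (2 : ℝ) ^ (Real.logb 2 x + 1) :=
        Real.rpow_le_rpow_of_exponent_le one_le_two (Int.ceil_lt_add_one _).le
    _ = 2 * x := by
        rw [Real.rpow_add two_pos, Real.rpow_logb two_pos (by norm_num) hx, Real.rpow_one,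
          mul_comm]

lemma Wcl_pos {ι : Type*} {wgt : ι → ℕ → ℝ} {nI : ι → ℕ} {e : ℕ} {N : ι → ℕ}
    (hw0 : ∀ ℓ, ∀ j ∈ Finset.Icc 1 (nI ℓ), 0 < wgt ℓ j) {ℓ : ι} (hℓ : e < N ℓ)
    (hN : N ℓ ≤ nI ℓ) : 0 < Wcl wgt ℓ (e + 1) (N ℓ) := by
  refine Finset.sum_pos (fun j hj => hw0 ℓ j ?_) (Finset.nonempty_Icc.2 hℓ)
  rw [Finset.mem_Icc] at hj ⊢
  omega

section

variable {ι : Type*} [Fintype ι] {ε : ℝ} {wgt : ι → ℕ → ℝ} {nI : ι → ℕ} {e : ℕ} {N : ι → ℕ}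

lemma Wcl_le_Ecl (hb : 0 < base ε wgt e N) (ℓ : ι) :
    Wcl wgt ℓ (e + 1) (N ℓ) ≤ Ecl ε wgt e N ℓ :=
  (div_le_iff₀ hb).1 (Int.le_ceil _)

lemma Ecl_le_Wcl_add_base (hb : 0 < base ε wgt e N) (ℓ : ι) :
    Ecl ε wgt e N ℓ ≤ Wcl wgt ℓ (e + 1) (N ℓ) + base ε wgt e N := by
  have h := mul_le_mul_of_nonneg_right
    (Int.ceil_lt_add_one (Wcl wgt ℓ (e + 1) (N ℓ) / base ε wgt e N)).le hb.le
  rwa [add_mul, div_mul_cancel₀ _ hb.ne', one_mul] at h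

lemma Wcl_upround_le_Ecl (hb : 0 < base ε wgt e N) {ℓ : ι} (hℓ : e < N ℓ) (hN : N ℓ ≤ nI ℓ) :
    Wcl wgt ℓ (e + 1) (upround ε wgt nI e N ℓ) ≤ Ecl ε wgt e N ℓ := by
  have hne : ((Finset.Icc (e + 1) (nI ℓ)).filter
      fun k => Wcl wgt ℓ (e + 1) k ≤ Ecl ε wgt e N ℓ).Nonempty :=
    ⟨N ℓ, Finset.mem_filter.2 ⟨Finset.mem_Icc.2 ⟨hℓ, hN⟩, Wcl_le_Ecl hb ℓ⟩⟩
  obtain ⟨k, hk, hk'⟩ := Finset.exists_mem_eq_sup _ hne id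
  rw [upround, if_pos hℓ, hk']
  exact (Finset.mem_filter.1 hk).2

end

end IK

/-- For every utilization vector `N`, the weight of the up-rounding beyond
the first `1/ε` items of the heavy classes satisfies `W_H(N^(1)) ≤ (1+2ε)·W_H(N)`, where
`W_H(N^(1)) = Σ_{ℓ∈H(N)} W_ℓ(1/ε+1, N^(1)_ℓ)` (recall `H(N^(1)) = H(N)`). -/
theorem stmt4 {ι : Type*} [Fintype ι] [Nonempty ι]
    (ε : ℝ) (e : ℕ) (hε0 : 0 < ε) (hε : ε < 1 / 4) (he : (e : ℝ) * ε = 1)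
    (nI : ι → ℕ) (wgt : ι → ℕ → ℝ)
    (hw0 : ∀ ℓ, ∀ j ∈ Finset.Icc 1 (nI ℓ), 0 < wgt ℓ j)
    (hwm : ∀ ℓ, ∀ j k : ℕ, 1 ≤ j → j ≤ k → k ≤ nI ℓ → wgt ℓ j ≤ wgt ℓ k)
    (N : ι → ℕ) (hN : ∀ ℓ, N ℓ ≤ nI ℓ) :
    ∑ ℓ ∈ IK.heavy e N, IK.Wcl wgt ℓ (e + 1) (IK.upround ε wgt nI e N ℓ)
      ≤ (1 + 2 * ε) * IK.WH wgt e N := by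
  rcases (IK.heavy e N).eq_empty_or_nonempty with hH | hH
  · simp [IK.WH, hH]
  have hheavy : ∀ ℓ ∈ IK.heavy e N, e < N ℓ := fun ℓ hℓ => (Finset.mem_filter.1 hℓ).2
  have hcard : (0 : ℝ) < Fintype.card ι := by exact_mod_cast Fintype.card_pos
  have hWH : 0 < IK.WH wgt e N :=
    Finset.sum_pos (fun ℓ hℓ => IK.Wcl_pos hw0 (hheavy ℓ hℓ) (hN ℓ)) hH
  have hx : 0 < ε / (Fintype.card ι) * IK.WH wgt e N := by positivity
  have hb : 0 < IK.base ε wgt e N := IK.P2_pos hx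
  have hcard_le : ((IK.heavy e N).card : ℝ) ≤ Fintype.card ι := by
    exact_mod_cast Finset.card_le_univ _
  calc ∑ ℓ ∈ IK.heavy e N, IK.Wcl wgt ℓ (e + 1) (IK.upround ε wgt nI e N ℓ)
      ≤ ∑ ℓ ∈ IK.heavy e N, (IK.Wcl wgt ℓ (e + 1) (N ℓ) + IK.base ε wgt e N) :=
        Finset.sum_le_sum fun ℓ hℓ =>
          (IK.Wcl_upround_le_Ecl hb (hheavy ℓ hℓ) (hN ℓ)).trans (IK.Ecl_le_Wcl_add_base hb ℓ)
    _ = IK.WH wgt e N + (IK.heavy e N).card * IK.base ε wgt e N := by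
        rw [Finset.sum_add_distrib, Finset.sum_const, nsmul_eq_mul, IK.WH]
    _ ≤ IK.WH wgt e N +
          Fintype.card ι * (2 * (ε / (Fintype.card ι) * IK.WH wgt e N)) := by
        gcongr
        exact IK.P2_le_two_mul hx
    _ = (1 + 2 * ε) * IK.WH wgt e N := by
        field_simp
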